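/- arXiv:1209.5548 — 5 statements merged into one kernel-verified Lean document; each statement's English description precedes it below -/
import Mathlib

section
/- Let m, v ∈ ℝ³ with ‖m‖ = 1 and ⟨m, v⟩ = 0, and let k ≥ 0. Then ‖(m + k·v)/‖m + k·v‖ − m‖ ≤ k·‖v‖. -/
open RealInnerProductSpace

/-- Normalizing a tangential perturbation of a unit vector moves it by at most the norm of the
perturbation. -/
theorem norm_normalize_add_sub_le {E : Type*} [NormedAddCommGroup E] [InnerProductSpace ℝ E]
    {m w : E} (hm : ‖m‖ = 1) (hmw : ⟪m, w⟫ = 0) :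
    ‖(‖m + w‖)⁻¹ • (m + w) - m‖ ≤ ‖w‖ := by
  have hsq : ‖m + w‖ ^ 2 = 1 + ‖w‖ ^ 2 := by
    rw [norm_add_sq_real, hm, hmw]
    ring
  have hinner : ⟪m + w, m⟫ = 1 := by
    rw [inner_add_left, real_inner_self_eq_norm_sq, hm, real_inner_comm, hmw]
    norm_num
  have hone : 1 ≤ ‖m + w‖ := by
    nlinarith [norm_nonneg (m + w), sq_nonneg ‖w‖]
  have hunit : ‖(‖m + w‖)⁻¹ • (m + w)‖ = 1 := by
    rw [norm_smul, norm_inv, norm_norm, inv_mul_cancel₀ (by positivity)]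
  refine le_of_sq_le_sq ?_ (norm_nonneg w)
  rw [norm_sub_sq_real, hunit, hm, real_inner_smul_left, hinner]
  have hinv : 1 - (‖m + w‖)⁻¹ ≤ ‖m + w‖ - 1 := by
    have hpos : 0 < ‖m + w‖ := by positivity
    have hcancel : ‖m + w‖ * (‖m + w‖)⁻¹ = 1 := mul_inv_cancel₀ hpos.ne'
    nlinarith [inv_pos.mpr hpos, sq_nonneg (‖m + w‖ - 1),
      mul_nonneg (inv_pos.mpr hpos).le (sq_nonneg (‖m + w‖ - 1))]
  nlinarith

theorem stmt_1 (m v : EuclideanSpace ℝ (Fin 3)) (hm : ‖m‖ = 1)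
    (hmv : ⟪m, v⟫ = 0) (k : ℝ) (hk : 0 ≤ k) :
    ‖(‖m + k • v‖)⁻¹ • (m + k • v) - m‖ ≤ k * ‖v‖ := by
  have hmw : ⟪m, k • v⟫ = 0 := by rw [real_inner_smul_right, hmv, mul_zero]
  simpa only [norm_smul, Real.norm_of_nonneg hk] using norm_normalize_add_sub_le hm hmw
end

section
/- Let m, v ∈ ℝ³ with ‖m‖ = 1 and ⟨m, v⟩ = 0, and let k ≥ 0. Then ‖(m + k·v)/‖m + k·v‖ − m − k·v‖ ≤ (1/2)·k²·‖v‖². -/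
open RealInnerProductSpace

/-- The distance from a nonzero vector to its normalization. -/
theorem norm_inv_norm_smul_sub_self {E : Type*} [NormedAddCommGroup E] [NormedSpace ℝ E]
    {w : E} (hw : w ≠ 0) : ‖‖w‖⁻¹ • w - w‖ = |1 - ‖w‖| := by
  have hn : ‖w‖ ≠ 0 := norm_ne_zero_iff.mpr hw
  calc ‖‖w‖⁻¹ • w - w‖ = ‖(‖w‖⁻¹ - 1) • w‖ := by rw [sub_smul, one_smul]
    _ = |(‖w‖⁻¹ - 1) * ‖w‖| := by rw [norm_smul, Real.norm_eq_abs, abs_mul, abs_norm]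
    _ = |1 - ‖w‖| := by rw [sub_mul, inv_mul_cancel₀ hn, one_mul]

theorem stmt_2 (m v : EuclideanSpace ℝ (Fin 3)) (hm : ‖m‖ = 1)
    (hmv : ⟪m, v⟫ = 0) (k : ℝ) (hk : 0 ≤ k) :
    ‖(‖m + k • v‖)⁻¹ • (m + k • v) - m - k • v‖ ≤ (1 / 2) * k ^ 2 * ‖v‖ ^ 2 := by
  have hsq : ‖m + k • v‖ ^ 2 = 1 + k ^ 2 * ‖v‖ ^ 2 := by
    rw [norm_add_sq_real, real_inner_smul_right, hmv, hm, norm_smul, Real.norm_eq_abs,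
      mul_pow, sq_abs]
    ring
  have hone : 1 ≤ ‖m + k • v‖ := by
    rw [← one_le_sq_iff₀ (norm_nonneg _), hsq]
    exact le_add_of_nonneg_right (by positivity)
  have hw : m + k • v ≠ 0 := norm_pos_iff.mp (one_pos.trans_le hone)
  rw [sub_sub, norm_inv_norm_smul_sub_self hw, abs_of_nonpos (by linarith)]
  nlinarith [sq_nonneg (‖m + k • v‖ - 1)]
end

section
/- Let 0 < γ ≤ L, let χ : [0,∞) → ℝ be continuous, and suppose that g : [0,∞) → ℝ defined by g(t) = t + χ(t)·t is differentiable with γ ≤ g'(t) ≤ L for all t ≥ 0. Define A : ℝ³ → ℝ³ by A(w) = (1 + χ(‖w‖))·w. Then for all u, v ∈ ℝ³, ‖A(u) − A(v)‖ ≤ L·‖u − v‖. -/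
open RealInnerProductSpace

/-- If `0 ≤ a, b ≤ L` and rescaling `u, v` by `a, b` changes the difference of norms by a factor of
at most `L`, then it changes the distance by a factor of at most `L`. The bounds on `a, b` are only
needed when `u, v` are nonzero. -/
theorem norm_smul_sub_smul_le_of_abs_le {E : Type*} [NormedAddCommGroup E] [InnerProductSpace ℝ E]
    {L a b : ℝ} {u v : E} (hL : 0 ≤ L) (ha : u ≠ 0 → 0 ≤ a ∧ a ≤ L) (hb : v ≠ 0 → 0 ≤ b ∧ b ≤ L)
    (h : |a * ‖u‖ - b * ‖v‖| ≤ L * |‖u‖ - ‖v‖|) :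
    ‖a • u - b • v‖ ≤ L * ‖u - v‖ := by
  have hcross : a * b * (‖u‖ * ‖v‖ - inner ℝ u v) ≤ L * L * (‖u‖ * ‖v‖ - inner ℝ u v) := by
    rcases eq_or_ne u 0 with rfl | hu
    · simp
    rcases eq_or_ne v 0 with rfl | hv
    · simp
    exact mul_le_mul_of_nonneg_right (mul_le_mul (ha hu).2 (hb hv).2 (hb hv).1 hL)
      (sub_nonneg.2 (real_inner_le_norm u v))
  have hradial : (a * ‖u‖ - b * ‖v‖) ^ 2 ≤ L ^ 2 * (‖u‖ - ‖v‖) ^ 2 := by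
    rw [← mul_pow]
    refine sq_le_sq.2 ?_
    rwa [abs_mul, abs_of_nonneg hL]
  refine le_of_sq_le_sq ?_ (by positivity)
  rw [mul_pow, norm_sub_sq_real, norm_sub_sq_real, real_inner_smul_left, real_inner_smul_right,
    norm_smul, norm_smul, mul_pow, mul_pow, Real.norm_eq_abs, Real.norm_eq_abs, sq_abs, sq_abs]
  linarith

theorem stmt_8 (γ L : ℝ) (hγ : 0 < γ) (hγL : γ ≤ L)
    (χ : ℝ → ℝ) (hχ : ContinuousOn χ (Set.Ici 0))
    (g g' : ℝ → ℝ) (hg : ∀ t ∈ Set.Ici (0 : ℝ), g t = t + χ t * t)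
    (hg' : ∀ t ∈ Set.Ici (0 : ℝ), HasDerivWithinAt g (g' t) (Set.Ici 0) t)
    (hbound : ∀ t ∈ Set.Ici (0 : ℝ), γ ≤ g' t ∧ g' t ≤ L)
    (A : EuclideanSpace ℝ (Fin 3) → EuclideanSpace ℝ (Fin 3))
    (hA : ∀ w, A w = (1 + χ ‖w‖) • w) :
    ∀ u v : EuclideanSpace ℝ (Fin 3), ‖A u - A v‖ ≤ L * ‖u - v‖ := by
  have hL : 0 ≤ L := hγ.le.trans hγL
  have hlip : ∀ x ∈ Set.Ici (0 : ℝ), ∀ y ∈ Set.Ici (0 : ℝ), |g y - g x| ≤ L * |y - x| :=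
    fun x hx y hy => (convex_Ici (0 : ℝ)).norm_image_sub_le_of_norm_hasDerivWithin_le hg'
      (fun t ht => abs_le.2 ⟨by linarith [(hbound t ht).1], (hbound t ht).2⟩) hx hy
  have hmono : MonotoneOn g (Set.Ici 0) :=
    monotoneOn_of_hasDerivWithinAt_nonneg (convex_Ici 0)
      (fun t ht => (hg' t ht).continuousWithinAt)
      (fun t ht => (hg' t (interior_subset ht)).mono interior_subset)
      (fun t ht => hγ.le.trans (hbound t (interior_subset ht)).1)
  have hg0 : g 0 = 0 := by simp [hg 0 Set.self_mem_Ici]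
  have hgmul : ∀ w : EuclideanSpace ℝ (Fin 3), g ‖w‖ = (1 + χ ‖w‖) * ‖w‖ := fun w => by
    rw [hg _ (norm_nonneg w)]
    ring
  have hcoef : ∀ w : EuclideanSpace ℝ (Fin 3), w ≠ 0 → 0 ≤ 1 + χ ‖w‖ ∧ 1 + χ ‖w‖ ≤ L := by
    intro w hw
    have hpos : 0 < ‖w‖ := norm_pos_iff.2 hw
    have hlow := hmono Set.self_mem_Ici hpos.le hpos.le
    have hup := (le_abs_self _).trans (hlip 0 Set.self_mem_Ici ‖w‖ hpos.le)
    rw [hg0, hgmul] at hlow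
    rw [hg0, hgmul, sub_zero, sub_zero, abs_of_pos hpos] at hup
    exact ⟨nonneg_of_mul_nonneg_left hlow hpos, le_of_mul_le_mul_right hup hpos⟩
  intro u v
  rw [hA, hA]
  refine norm_smul_sub_smul_le_of_abs_le hL (hcoef u) (hcoef v) ?_
  rw [← hgmul, ← hgmul]
  exact hlip _ (norm_nonneg v) _ (norm_nonneg u)
end

section
/- Let 0 < γ ≤ L, let χ : [0,∞) → ℝ be continuous, and suppose that g : [0,∞) → ℝ defined by g(t) = t + χ(t)·t is differentiable with γ ≤ g'(t) ≤ L for all t ≥ 0. Define A : ℝ³ → ℝ³ by A(w) = (1 + χ(‖w‖))·w. Then for all u, v ∈ ℝ³, ⟨A(u) − A(v), u − v⟩ ≥ γ·‖u − v‖². -/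
open RealInnerProductSpace

/-- A function on `[0, ∞)` with derivative at least `γ` grows at least at rate `γ`. -/
theorem mul_sub_le_sub_of_le_hasDerivWithinAt_Ici {γ : ℝ} {g g' : ℝ → ℝ}
    (hg' : ∀ t ∈ Set.Ici (0 : ℝ), HasDerivWithinAt g (g' t) (Set.Ici 0) t)
    (hbound : ∀ t ∈ Set.Ici (0 : ℝ), γ ≤ g' t) {s t : ℝ} (hs : 0 ≤ s) (hst : s ≤ t) :
    γ * (t - s) ≤ g t - g s := by
  have hderiv : ∀ x ∈ interior (Set.Ici (0 : ℝ)), HasDerivAt g (g' x) x := fun x hx =>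
    (hg' x (interior_subset hx)).hasDerivAt (mem_interior_iff_mem_nhds.1 hx)
  exact (convex_Ici (0 : ℝ)).mul_sub_le_image_sub_of_le_deriv
    (fun x hx => (hg' x hx).continuousWithinAt)
    (fun x hx => (hderiv x hx).differentiableAt.differentiableWithinAt)
    (fun x hx => (hderiv x hx).deriv ▸ hbound x (interior_subset hx))
    s hs t (hs.trans hst) hst

/-- Cauchy–Schwarz scaled by a factor that need only be nonnegative after multiplication
by the norm of the first vector. -/
theorem mul_inner_le_mul_norm_mul_norm {E : Type*} [NormedAddCommGroup E] [InnerProductSpace ℝ E]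
    {a : ℝ} {u : E} (v : E) (ha : 0 ≤ a * ‖u‖) : a * ⟪u, v⟫ ≤ a * (‖u‖ * ‖v‖) := by
  rcases eq_or_ne u 0 with rfl | hu
  · simp
  · exact mul_le_mul_of_nonneg_left (real_inner_le_norm u v)
      (nonneg_of_mul_nonneg_left ha (norm_pos_iff.2 hu))

/-- Strong monotonicity of a radial pair of values `a • u`, `b • v`, from strong monotonicity
of the radial profile. -/
theorem mul_norm_sub_sq_le_inner_smul_sub_smul {E : Type*} [NormedAddCommGroup E]
    [InnerProductSpace ℝ E] {γ a b : ℝ} {u v : E} (ha : γ * ‖u‖ ≤ a * ‖u‖) (hb : γ * ‖v‖ ≤ b * ‖v‖)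
    (hab : γ * (‖u‖ - ‖v‖) ^ 2 ≤ (a * ‖u‖ - b * ‖v‖) * (‖u‖ - ‖v‖)) :
    γ * ‖u - v‖ ^ 2 ≤ ⟪a • u - b • v, u - v⟫ := by
  have hu := mul_inner_le_mul_norm_mul_norm (a := a - γ) (u := u) v (by linarith)
  have hv := mul_inner_le_mul_norm_mul_norm (a := b - γ) (u := v) u (by linarith)
  rw [real_inner_comm] at hv
  rw [norm_sub_sq_real]
  simp only [inner_sub_left, inner_sub_right, real_inner_smul_left, real_inner_self_eq_norm_sq,
    real_inner_comm u v] at *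
  linarith

theorem stmt_9 (γ L : ℝ) (hγ : 0 < γ) (hγL : γ ≤ L)
    (χ : ℝ → ℝ) (hχ : ContinuousOn χ (Set.Ici 0))
    (g g' : ℝ → ℝ) (hg : ∀ t ∈ Set.Ici (0 : ℝ), g t = t + χ t * t)
    (hg' : ∀ t ∈ Set.Ici (0 : ℝ), HasDerivWithinAt g (g' t) (Set.Ici 0) t)
    (hbound : ∀ t ∈ Set.Ici (0 : ℝ), γ ≤ g' t ∧ g' t ≤ L)
    (A : EuclideanSpace ℝ (Fin 3) → EuclideanSpace ℝ (Fin 3))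
    (hA : ∀ w, A w = (1 + χ ‖w‖) • w) :
    ∀ u v : EuclideanSpace ℝ (Fin 3), γ * ‖u - v‖ ^ 2 ≤ ⟪A u - A v, u - v⟫ := by
  intro u v
  have growth : ∀ {s t : ℝ}, 0 ≤ s → s ≤ t → γ * (t - s) ≤ g t - g s :=
    mul_sub_le_sub_of_le_hasDerivWithinAt_Ici hg' fun t ht => (hbound t ht).1
  have profile : ∀ w : EuclideanSpace ℝ (Fin 3), (1 + χ ‖w‖) * ‖w‖ = g ‖w‖ := fun w => by
    rw [hg _ (norm_nonneg w)]; ring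
  have lower : ∀ w : EuclideanSpace ℝ (Fin 3), γ * ‖w‖ ≤ (1 + χ ‖w‖) * ‖w‖ := fun w => by
    have h := growth le_rfl (norm_nonneg w)
    rw [hg 0 Set.self_mem_Ici] at h
    rw [profile]
    linarith
  rw [hA, hA]
  refine mul_norm_sub_sq_le_inner_smul_sub_smul (lower u) (lower v) ?_
  rw [profile, profile]
  rcases le_total ‖v‖ ‖u‖ with h | h
  · nlinarith [mul_le_mul_of_nonneg_right (growth (norm_nonneg v) h) (sub_nonneg.2 h)]
  · nlinarith [mul_le_mul_of_nonneg_right (growth (norm_nonneg u) h) (sub_nonneg.2 h)]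
end

section
/- Let (Ω, μ) be a measure space, let 0 < γ ≤ L, let χ : [0,∞) → ℝ be continuous, and suppose that g : [0,∞) → ℝ defined by g(t) = t + χ(t)·t is differentiable with γ ≤ g'(t) ≤ L for all t ≥ 0. Define A : ℝ³ → ℝ³ by A(w) = (1 + χ(‖w‖))·w. Then for all measurable u, v : Ω → ℝ³ with ∫ ‖u‖² dμ < ∞ and ∫ ‖v‖² dμ < ∞, the following two inequalities hold: (1) L⁻²·∫ ‖A∘u − A∘v‖² dμ ≤ ∫ ‖u − v‖² dμ, and (2) ∫ ‖u − v‖² dμ ≤ γ⁻¹·∫ ⟨A(u(x)) − A(v(x)), u(x) − v(x)⟩ dμ(x). -/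
open RealInnerProductSpace MeasureTheory

section RadialMap

variable {E : Type*} [NormedAddCommGroup E] [InnerProductSpace ℝ E]

/-- Two-sided slope bounds on `[0, ∞)` from two-sided bounds on the one-sided derivative. -/
lemma slope_bounds_of_hasDerivWithinAt_Ici {γ L : ℝ} {g g' : ℝ → ℝ}
    (hg' : ∀ t ∈ Set.Ici (0 : ℝ), HasDerivWithinAt g (g' t) (Set.Ici 0) t)
    (hbound : ∀ t ∈ Set.Ici (0 : ℝ), γ ≤ g' t ∧ g' t ≤ L)
    {a b : ℝ} (ha : 0 ≤ a) (hab : a ≤ b) :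
    γ * (b - a) ≤ g b - g a ∧ g b - g a ≤ L * (b - a) := by
  have hcont : ContinuousOn g (Set.Ici 0) := fun t ht => (hg' t ht).continuousWithinAt
  have hderiv : ∀ t ∈ interior (Set.Ici (0 : ℝ)), HasDerivAt g (g' t) t := fun t ht =>
    (hg' t (interior_subset ht)).hasDerivAt (mem_interior_iff_mem_nhds.mp ht)
  have hdiff : DifferentiableOn ℝ g (interior (Set.Ici 0)) := fun t ht =>
    (hderiv t ht).differentiableAt.differentiableWithinAt
  constructor
  · refine (convex_Ici 0).mul_sub_le_image_sub_of_le_deriv hcont hdiff (fun t ht => ?_)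
      a ha b (ha.trans hab) hab
    rw [(hderiv t ht).deriv]
    exact (hbound t (interior_subset ht)).1
  · refine (convex_Ici 0).image_sub_le_mul_sub_of_deriv_le hcont hdiff (fun t ht => ?_)
      a ha b (ha.trans hab) hab
    rw [(hderiv t ht).deriv]
    exact (hbound t (interior_subset ht)).2

lemma norm_sq_smul_sub_smul (α β : ℝ) (w z : E) :
    ‖α • w - β • z‖ ^ 2 =
      (α * ‖w‖ - β * ‖z‖) ^ 2 + 2 * (α * β * (‖w‖ * ‖z‖ - ⟪w, z⟫)) := by
  rw [norm_sub_sq_real, real_inner_smul_left, real_inner_smul_right, norm_smul, norm_smul,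
    mul_pow, mul_pow, Real.norm_eq_abs, Real.norm_eq_abs, sq_abs, sq_abs]
  ring

lemma inner_smul_sub_smul_sub (α β : ℝ) (w z : E) :
    ⟪α • w - β • z, w - z⟫ =
      (α * ‖w‖ - β * ‖z‖) * (‖w‖ - ‖z‖) + (α + β) * (‖w‖ * ‖z‖ - ⟪w, z⟫) := by
  simp only [inner_sub_left, inner_sub_right, real_inner_smul_left,
    real_inner_self_eq_norm_sq, real_inner_comm w z]
  ring

/-- If `t ↦ φ t * t` has slopes in `[γ, L]` on `[0, ∞)`, the radial map `w ↦ φ ‖w‖ • w` is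
`L`-Lipschitz and `γ`-strongly monotone. -/
lemma radial_lipschitz_and_strongly_monotone {γ L : ℝ} (hγ : 0 < γ) {φ : ℝ → ℝ}
    (hφ : ∀ a b : ℝ, 0 ≤ a → a ≤ b →
      γ * (b - a) ≤ φ b * b - φ a * a ∧ φ b * b - φ a * a ≤ L * (b - a)) (w z : E) :
    ‖φ ‖w‖ • w - φ ‖z‖ • z‖ ^ 2 ≤ L ^ 2 * ‖w - z‖ ^ 2 ∧
      γ * ‖w - z‖ ^ 2 ≤ ⟪φ ‖w‖ • w - φ ‖z‖ • z, w - z⟫ := by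
  have hφ_mem : ∀ a : ℝ, 0 < a → γ ≤ φ a ∧ φ a ≤ L := fun a ha => by
    have h := hφ 0 a le_rfl ha.le
    simp only [mul_zero, sub_zero] at h
    exact ⟨le_of_mul_le_mul_right h.1 ha, le_of_mul_le_mul_right h.2 ha⟩
  have hdist : ‖w - z‖ ^ 2 = (‖w‖ - ‖z‖) ^ 2 + 2 * (‖w‖ * ‖z‖ - ⟪w, z⟫) := by
    rw [norm_sub_sq_real]
    ring
  have hgap : 0 ≤ ‖w‖ * ‖z‖ - ⟪w, z⟫ := sub_nonneg.mpr (real_inner_le_norm w z)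
  have hangular : φ ‖w‖ * φ ‖z‖ * (‖w‖ * ‖z‖ - ⟪w, z⟫) ≤ L ^ 2 * (‖w‖ * ‖z‖ - ⟪w, z⟫) ∧
      2 * γ * (‖w‖ * ‖z‖ - ⟪w, z⟫) ≤ (φ ‖w‖ + φ ‖z‖) * (‖w‖ * ‖z‖ - ⟪w, z⟫) := by
    rcases eq_or_ne w 0 with rfl | hw
    · simp
    rcases eq_or_ne z 0 with rfl | hz
    · simp
    obtain ⟨hw₁, hw₂⟩ := hφ_mem _ (norm_pos_iff.mpr hw)
    obtain ⟨hz₁, hz₂⟩ := hφ_mem _ (norm_pos_iff.mpr hz)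
    constructor <;> refine mul_le_mul_of_nonneg_right ?_ hgap
    · rw [sq]
      exact mul_le_mul hw₂ hz₂ (hγ.le.trans hz₁) (hγ.le.trans (hw₁.trans hw₂))
    · linarith
  have hradial : (φ ‖w‖ * ‖w‖ - φ ‖z‖ * ‖z‖) ^ 2 ≤ L ^ 2 * (‖w‖ - ‖z‖) ^ 2 ∧
      γ * (‖w‖ - ‖z‖) ^ 2 ≤ (φ ‖w‖ * ‖w‖ - φ ‖z‖ * ‖z‖) * (‖w‖ - ‖z‖) := by
    have key : ∀ a b : ℝ, 0 ≤ a → a ≤ b →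
        (φ b * b - φ a * a) ^ 2 ≤ L ^ 2 * (b - a) ^ 2 ∧
          γ * (b - a) ^ 2 ≤ (φ b * b - φ a * a) * (b - a) := fun a b ha hab => by
      obtain ⟨h₁, h₂⟩ := hφ a b ha hab
      have hba : 0 ≤ b - a := sub_nonneg.mpr hab
      constructor
      · rw [← mul_pow]
        exact pow_le_pow_left₀ ((mul_nonneg hγ.le hba).trans h₁) h₂ 2
      · rw [sq, ← mul_assoc]
        exact mul_le_mul_of_nonneg_right h₁ hba
    rcases le_total ‖z‖ ‖w‖ with h | h
    · exact key _ _ (norm_nonneg z) h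
    · obtain ⟨h₁, h₂⟩ := key _ _ (norm_nonneg w) h
      constructor <;> linarith
  rw [norm_sq_smul_sub_smul, inner_smul_sub_smul_sub, hdist]
  constructor <;> linarith [hradial.1, hradial.2, hangular.1, hangular.2]

end RadialMap

theorem stmt_10 {Ω : Type*} [MeasurableSpace Ω] (μ : Measure Ω)
    (γ L : ℝ) (hγ : 0 < γ) (hγL : γ ≤ L)
    (χ : ℝ → ℝ) (hχ : ContinuousOn χ (Set.Ici 0))
    (g g' : ℝ → ℝ) (hg : ∀ t ∈ Set.Ici (0 : ℝ), g t = t + χ t * t)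
    (hg' : ∀ t ∈ Set.Ici (0 : ℝ), HasDerivWithinAt g (g' t) (Set.Ici 0) t)
    (hbound : ∀ t ∈ Set.Ici (0 : ℝ), γ ≤ g' t ∧ g' t ≤ L)
    (A : EuclideanSpace ℝ (Fin 3) → EuclideanSpace ℝ (Fin 3))
    (hA : ∀ w, A w = (1 + χ ‖w‖) • w)
    (u v : Ω → EuclideanSpace ℝ (Fin 3)) (hu : Measurable u) (hv : Measurable v)
    (hu2 : Integrable (fun x => ‖u x‖ ^ 2) μ)
    (hv2 : Integrable (fun x => ‖v x‖ ^ 2) μ) :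
    L⁻¹ ^ 2 * ∫ x, ‖A (u x) - A (v x)‖ ^ 2 ∂μ ≤ ∫ x, ‖u x - v x‖ ^ 2 ∂μ ∧
      ∫ x, ‖u x - v x‖ ^ 2 ∂μ ≤ γ⁻¹ * ∫ x, ⟪A (u x) - A (v x), u x - v x⟫ ∂μ := by
  have hL : 0 < L := hγ.trans_le hγL
  have hpt : ∀ w z, ‖A w - A z‖ ^ 2 ≤ L ^ 2 * ‖w - z‖ ^ 2 ∧
      γ * ‖w - z‖ ^ 2 ≤ ⟪A w - A z, w - z⟫ := fun w z => by
    rw [hA w, hA z]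
    refine radial_lipschitz_and_strongly_monotone (φ := fun t => 1 + χ t) hγ
      (fun a b ha hab => ?_) w z
    have h := slope_bounds_of_hasDerivWithinAt_Ici hg' hbound ha hab
    rw [hg a ha, hg b (ha.trans hab)] at h
    simpa only [add_mul, one_mul] using h
  have hnorm : ∀ w z, ‖A w - A z‖ ≤ L * ‖w - z‖ := fun w z =>
    le_of_sq_le_sq (by rw [mul_pow]; exact (hpt w z).1) (by positivity)
  have hAcont : Continuous A := by
    refine (LipschitzWith.of_dist_le_mul (K := L.toNNReal) fun w z => ?_).continuous
    rw [dist_eq_norm, dist_eq_norm, Real.coe_toNNReal L hL.le]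
    exact hnorm w z
  have huv : Integrable (fun x => ‖u x - v x‖ ^ 2) μ :=
    (((memLp_two_iff_integrable_sq_norm hu.aestronglyMeasurable).mpr hu2).sub
      ((memLp_two_iff_integrable_sq_norm hv.aestronglyMeasurable).mpr hv2)).integrable_norm_pow
      two_ne_zero
  have hinner : Integrable (fun x => ⟪A (u x) - A (v x), u x - v x⟫) μ := by
    refine (huv.const_mul L).mono' (Measurable.aestronglyMeasurable ?_) (ae_of_all _ fun x => ?_)
    · exact ((hAcont.measurable.comp hu).sub (hAcont.measurable.comp hv)).inner (hu.sub hv)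
    · refine (norm_inner_le_norm _ _).trans ?_
      rw [sq, ← mul_assoc]
      exact mul_le_mul_of_nonneg_right (hnorm _ _) (norm_nonneg _)
  constructor
  · rw [inv_pow, inv_mul_le_iff₀ (by positivity), ← integral_const_mul]
    exact integral_mono_of_nonneg (ae_of_all _ fun x => by positivity) (huv.const_mul _)
      (ae_of_all _ fun x => (hpt _ _).1)
  · rw [le_inv_mul_iff₀ hγ, ← integral_const_mul]
    exact integral_mono (huv.const_mul _) hinner fun x => (hpt _ _).2
end
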